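/- Uniqueness of normal forms: every SAND attack tree rewrites under the term rewriting system ⇒ to a normal form that is unique up to permuting the arguments of OR and AND nodes; that is, if n1 and n2 are both normal forms reachable by rewriting from the same SAND attack tree t, then n1 = n2 (modulo commutativity of OR and AND). -/

import Mathlib

/-!
Formalization of "Attack Trees with Sequential Conjunction".

Source-sink graphs over a set `B` of basic actions: a vertex type `V`,
a multiset of labeled edges, a source `s` and a sink `z` with `s ≠ z`.
-/

structure SSG (B : Type) : Type 1 where
  V : Type
  deq : DecidableEq V
  E : Multiset (V × B × V)
  s : V
  z : V
  ne : s ≠ z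

namespace SSG

variable {B : Type}

/-- The graph with a single edge labeled `b`. -/
def single (b : B) : SSG B where
  V := Bool
  deq := inferInstance
  E := {(false, b, true)}
  s := false
  z := true
  ne := Bool.false_ne_true

/-- In the sequential composition, the sink of the first graph is identified with
the source of the second graph. -/
def seqEmbed (G G' : SSG B) (v : G.V) : ({u : G.V // u ≠ G.z} ⊕ G'.V) :=
  haveI := G.deq
  if h : v = G.z then Sum.inr G'.s else Sum.inl ⟨v, h⟩

/-- Sequential composition `G ⋅ G'` of source-sink graphs: the disjoint union in which
the sink of `G` is identified with the source of `G'`. -/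
def seq (G G' : SSG B) : SSG B where
  V := {u : G.V // u ≠ G.z} ⊕ G'.V
  deq := by haveI := G.deq; haveI := G'.deq; infer_instance
  E := G.E.map (fun e => (G.seqEmbed G' e.1, e.2.1, G.seqEmbed G' e.2.2)) +
       G'.E.map (fun e => (Sum.inr e.1, e.2.1, Sum.inr e.2.2))
  s := Sum.inl ⟨G.s, G.ne⟩
  z := Sum.inr G'.z
  ne := by simp

/-- In the parallel composition, the two sources are identified and the two sinks
are identified. -/
def parEmbed (G G' : SSG B) (v : G.V) : ({u : G.V // u ≠ G.s ∧ u ≠ G.z} ⊕ G'.V) :=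
  haveI := G.deq
  if hs : v = G.s then Sum.inr G'.s
  else if hz : v = G.z then Sum.inr G'.z
  else Sum.inl ⟨v, hs, hz⟩

/-- Parallel composition `G ∥ G'` of source-sink graphs: the disjoint union in which
the two sources are identified and the two sinks are identified. -/
def par (G G' : SSG B) : SSG B where
  V := {u : G.V // u ≠ G.s ∧ u ≠ G.z} ⊕ G'.V
  deq := by haveI := G.deq; haveI := G'.deq; infer_instance
  E := G.E.map (fun e => (G.parEmbed G' e.1, e.2.1, G.parEmbed G' e.2.2)) +
       G'.E.map (fun e => (Sum.inr e.1, e.2.1, Sum.inr e.2.2))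
  s := Sum.inr G'.s
  z := Sum.inr G'.z
  ne := fun h => G'.ne (Sum.inr_injective h)

/-- Two source-sink graphs are equal (isomorphic) if there is a bijection between their
vertex sets that preserves the labeled edges (and hence source and sink). -/
def Iso (G G' : SSG B) : Prop :=
  ∃ f : G.V ≃ G'.V,
    G.E.map (fun e => (f e.1, e.2.1, f e.2.2)) = G'.E ∧ f G.s = G'.s ∧ f G.z = G'.z

/-- Directed adjacency: there is an edge from `u` to `v`. -/
def Adj (G : SSG B) (u v : G.V) : Prop := ∃ b, (u, b, v) ∈ G.E

/-- Series-parallel graphs (SP graphs): built from single edges by sequential and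
parallel composition; as SP graphs are considered up to isomorphism, the collection
is closed under isomorphism. -/
inductive IsSP : SSG B → Prop
  | single (b : B) : IsSP (single b)
  | seq {G G' : SSG B} : IsSP G → IsSP G' → IsSP (G.seq G')
  | par {G G' : SSG B} : IsSP G → IsSP G' → IsSP (G.par G')
  | iso {G G' : SSG B} : IsSP G → G.Iso G' → IsSP G'

/-- A graph is connected if any two vertices are joined by a path in the
underlying undirected graph. -/
def Connected (G : SSG B) : Prop :=
  ∀ u v : G.V, Relation.ReflTransGen (fun a b => G.Adj a b ∨ G.Adj b a) u v

/-- A directed graph is acyclic if it has no (nonempty) directed cycle. -/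
def Acyclic (G : SSG B) : Prop := ∀ v : G.V, ¬ Relation.TransGen G.Adj v v

end SSG
/-!
SAND attack trees: closed terms over `B ∪ {OR, AND, SAND}`, where the unranked
operators take `k ≥ 1` arguments (represented by nonempty lists `SandTreeList`).
-/

mutual
inductive SandTree (B : Type) : Type
  | atom : B → SandTree B
  | or : SandTreeList B → SandTree B
  | and : SandTreeList B → SandTree B
  | sand : SandTreeList B → SandTree B
inductive SandTreeList (B : Type) : Type
  | single : SandTree B → SandTreeList B
  | cons : SandTree B → SandTreeList B → SandTreeList B
end

namespace SandTreeList

variable {B : Type}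

def toList : SandTreeList B → List (SandTree B)
  | .single t => [t]
  | .cons t ts => t :: ts.toList

/-- Prepend a (possibly empty) list of trees to a nonempty argument list. -/
def glue : List (SandTree B) → SandTreeList B → SandTreeList B
  | [], ys => ys
  | x :: xs, ys => .cons x (glue xs ys)

/-- The nonempty argument list `t :: l`. -/
def ofList : SandTree B → List (SandTree B) → SandTreeList B
  | t, [] => .single t
  | t, u :: us => .cons t (ofList u us)

/-- Append a (possibly empty) list of trees to a nonempty argument list. -/
def snoc : SandTreeList B → List (SandTree B) → SandTreeList B
  | .single t, zs => ofList t zs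
  | .cons t ts, zs => .cons t (snoc ts zs)

def map (f : SandTree B → SandTree B) : SandTreeList B → SandTreeList B
  | .single t => .single (f t)
  | .cons t ts => .cons (f t) (map f ts)

end SandTreeList

/-!
The SP semantics `sem` interprets a SAND attack tree as a set of SP graphs
(sets of source-sink graphs closed under isomorphism, since SP graphs are
considered up to isomorphism):
`⟦b⟧ = {→b}`, `⟦OR(t₁,…,t_k)⟧ = ⋃ᵢ ⟦tᵢ⟧`,
`⟦AND(t₁,…,t_k)⟧ = {G₁ ∥ … ∥ G_k | Gᵢ ∈ ⟦tᵢ⟧}`,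
`⟦SAND(t₁,…,t_k)⟧ = {G₁ ⋅ … ⋅ G_k | Gᵢ ∈ ⟦tᵢ⟧}`.
-/

mutual
def sem {B : Type} : SandTree B → Set (SSG B)
  | .atom b => {G | (SSG.single b).Iso G}
  | .or ts => semOr ts
  | .and ts => semAnd ts
  | .sand ts => semSand ts
def semOr {B : Type} : SandTreeList B → Set (SSG B)
  | .single t => sem t
  | .cons t ts => sem t ∪ semOr ts
def semAnd {B : Type} : SandTreeList B → Set (SSG B)
  | .single t => sem t
  | .cons t ts => {G | ∃ G1 ∈ sem t, ∃ G2 ∈ semAnd ts, (G1.par G2).Iso G}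
def semSand {B : Type} : SandTreeList B → Set (SSG B)
  | .single t => sem t
  | .cons t ts => {G | ∃ G1 ∈ sem t, ∃ G2 ∈ semSand ts, (G1.seq G2).Iso G}
end
/-!
Equality of terms modulo commutativity of the unranked operators `OR` and `AND`
(the congruence generated by permuting the arguments of `OR` and `AND` nodes).
-/

mutual
inductive PEq {B : Type} : SandTree B → SandTree B → Prop
  | refl (t : SandTree B) : PEq t t
  | symm {t u : SandTree B} : PEq t u → PEq u t
  | trans {t u v : SandTree B} : PEq t u → PEq u v → PEq t v
  | orPerm {ts ts' : SandTreeList B} : ts.toList.Perm ts'.toList → PEq (.or ts) (.or ts')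
  | andPerm {ts ts' : SandTreeList B} : ts.toList.Perm ts'.toList → PEq (.and ts) (.and ts')
  | orCongr {ts ts' : SandTreeList B} : PEqL ts ts' → PEq (.or ts) (.or ts')
  | andCongr {ts ts' : SandTreeList B} : PEqL ts ts' → PEq (.and ts) (.and ts')
  | sandCongr {ts ts' : SandTreeList B} : PEqL ts ts' → PEq (.sand ts) (.sand ts')
inductive PEqL {B : Type} : SandTreeList B → SandTreeList B → Prop
  | single {t t' : SandTree B} : PEq t t' → PEqL (.single t) (.single t')
  | cons {t t' : SandTree B} {ts ts' : SandTreeList B} :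
      PEq t t' → PEqL ts ts' → PEqL (.cons t ts) (.cons t' ts')
end
/-!
Syntactic consequence from the axiom system `E_SP`.

The axiom schemes are represented by all of their instances (arbitrary argument
terms in place of the variable vectors `X⃗`, `Y⃗`, `Z⃗`); on closed terms this
generates exactly the same derivability relation as variables plus the
substitution rule.  Closure under "replacement in contexts" is represented by
the congruence rules for the three operators.
-/

section
open SandTreeList
mutual
inductive DerivSP {B : Type} : SandTree B → SandTree B → Prop
  /- closure rules -/
  | refl (t : SandTree B) : DerivSP t t
  | symm {t u : SandTree B} : DerivSP t u → DerivSP u t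
  | trans {t u v : SandTree B} : DerivSP t u → DerivSP u v → DerivSP t v
  | congrOr {ts ts' : SandTreeList B} : DerivSPL ts ts' → DerivSP (.or ts) (.or ts')
  | congrAnd {ts ts' : SandTreeList B} : DerivSPL ts ts' → DerivSP (.and ts) (.and ts')
  | congrSand {ts ts' : SandTreeList B} : DerivSPL ts ts' → DerivSP (.sand ts) (.sand ts')
  /- (E1) commutativity of OR -/
  | ax1 {ts ts' : SandTreeList B} : ts.toList.Perm ts'.toList → DerivSP (.or ts) (.or ts')
  /- (E2) commutativity of AND -/
  | ax2 {ts ts' : SandTreeList B} : ts.toList.Perm ts'.toList → DerivSP (.and ts) (.and ts')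
  /- (E3) OR(X⃗, OR(Y⃗)) = OR(X⃗, Y⃗) -/
  | ax3 (xs : List (SandTree B)) (ys : SandTreeList B) :
      DerivSP (.or (glue xs (.single (.or ys)))) (.or (glue xs ys))
  /- (E4) AND(X⃗, AND(Y⃗)) = AND(X⃗, Y⃗) -/
  | ax4 (xs : List (SandTree B)) (ys : SandTreeList B) :
      DerivSP (.and (glue xs (.single (.and ys)))) (.and (glue xs ys))
  /- (E4') SAND(X⃗, SAND(Y⃗), Z⃗) = SAND(X⃗, Y⃗, Z⃗) -/
  | ax4' (xs : List (SandTree B)) (ys : SandTreeList B) (zs : List (SandTree B)) :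
      DerivSP (.sand (glue xs (snoc (.single (.sand ys)) zs))) (.sand (glue xs (snoc ys zs)))
  /- (E5) OR(A) = A -/
  | ax5 (t : SandTree B) : DerivSP (.or (.single t)) t
  /- (E6) AND(A) = A -/
  | ax6 (t : SandTree B) : DerivSP (.and (.single t)) t
  /- (E6') SAND(A) = A -/
  | ax6' (t : SandTree B) : DerivSP (.sand (.single t)) t
  /- (E10) AND(X⃗, OR(Y⃗)) = OR(AND(X⃗,Y₁),…,AND(X⃗,Yₗ)) -/
  | ax10 (xs : List (SandTree B)) (ys : SandTreeList B) :
      DerivSP (.and (glue xs (.single (.or ys))))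
        (.or (SandTreeList.map (fun y => .and (glue xs (.single y))) ys))
  /- (E10') SAND(X⃗, OR(Y⃗), Z⃗) = OR(SAND(X⃗,Y₁,Z⃗),…,SAND(X⃗,Yₗ,Z⃗)) -/
  | ax10' (xs : List (SandTree B)) (ys : SandTreeList B) (zs : List (SandTree B)) :
      DerivSP (.sand (glue xs (snoc (.single (.or ys)) zs)))
        (.or (SandTreeList.map (fun y => .sand (glue xs (snoc (.single y) zs))) ys))
  /- (E11) OR(A, A, X⃗) = OR(A, X⃗) -/
  | ax11 (a : SandTree B) (xs : List (SandTree B)) :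
      DerivSP (.or (.cons a (ofList a xs))) (.or (ofList a xs))
inductive DerivSPL {B : Type} : SandTreeList B → SandTreeList B → Prop
  | single {t t' : SandTree B} : DerivSP t t' → DerivSPL (.single t) (.single t')
  | cons {t t' : SandTree B} {ts ts' : SandTreeList B} :
      DerivSP t t' → DerivSPL ts ts' → DerivSPL (.cons t ts) (.cons t' ts')
end
end

/-! Syntactic consequence from the SAND-free fragment
`E_SM = {E1, E2, E3, E4, E5, E6, E10, E11}` of `E_SP` (formulated over the full
signature of SAND attack trees). -/
section
open SandTreeList
mutual
inductive DerivSM {B : Type} : SandTree B → SandTree B → Prop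
  | refl (t : SandTree B) : DerivSM t t
  | symm {t u : SandTree B} : DerivSM t u → DerivSM u t
  | trans {t u v : SandTree B} : DerivSM t u → DerivSM u v → DerivSM t v
  | congrOr {ts ts' : SandTreeList B} : DerivSML ts ts' → DerivSM (.or ts) (.or ts')
  | congrAnd {ts ts' : SandTreeList B} : DerivSML ts ts' → DerivSM (.and ts) (.and ts')
  | congrSand {ts ts' : SandTreeList B} : DerivSML ts ts' → DerivSM (.sand ts) (.sand ts')
  | ax1 {ts ts' : SandTreeList B} : ts.toList.Perm ts'.toList → DerivSM (.or ts) (.or ts')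
  | ax2 {ts ts' : SandTreeList B} : ts.toList.Perm ts'.toList → DerivSM (.and ts) (.and ts')
  | ax3 (xs : List (SandTree B)) (ys : SandTreeList B) :
      DerivSM (.or (glue xs (.single (.or ys)))) (.or (glue xs ys))
  | ax4 (xs : List (SandTree B)) (ys : SandTreeList B) :
      DerivSM (.and (glue xs (.single (.and ys)))) (.and (glue xs ys))
  | ax5 (t : SandTree B) : DerivSM (.or (.single t)) t
  | ax6 (t : SandTree B) : DerivSM (.and (.single t)) t
  | ax10 (xs : List (SandTree B)) (ys : SandTreeList B) :
      DerivSM (.and (glue xs (.single (.or ys))))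
        (.or (SandTreeList.map (fun y => .and (glue xs (.single y))) ys))
  | ax11 (a : SandTree B) (xs : List (SandTree B)) :
      DerivSM (.or (.cons a (ofList a xs))) (.or (ofList a xs))
inductive DerivSML {B : Type} : SandTreeList B → SandTreeList B → Prop
  | single {t t' : SandTree B} : DerivSM t t' → DerivSML (.single t) (.single t')
  | cons {t t' : SandTree B} {ts ts' : SandTreeList B} :
      DerivSM t t' → DerivSML ts ts' → DerivSML (.cons t ts) (.cons t' ts')
end
end
/-!
The normal-form grammar (for `k ≥ 2`, `b ∈ B`):
`N ::= A | OR(A₁,…,A_k)` (with pairwise distinct `Aᵢ`),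
`A ::= C | S`, `C ::= b | AND(S₁,…,S_k)`, `S ::= b | SAND(C₁,…,C_k)`.
-/

mutual
inductive IsC {B : Type} : SandTree B → Prop
  | atom (b : B) : IsC (.atom b)
  | and {ts : SandTreeList B} : 2 ≤ ts.toList.length → IsSL ts → IsC (.and ts)
inductive IsS {B : Type} : SandTree B → Prop
  | atom (b : B) : IsS (.atom b)
  | sand {ts : SandTreeList B} : 2 ≤ ts.toList.length → IsCL ts → IsS (.sand ts)
inductive IsSL {B : Type} : SandTreeList B → Prop
  | single {t : SandTree B} : IsS t → IsSL (.single t)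
  | cons {t : SandTree B} {ts : SandTreeList B} : IsS t → IsSL ts → IsSL (.cons t ts)
inductive IsCL {B : Type} : SandTreeList B → Prop
  | single {t : SandTree B} : IsC t → IsCL (.single t)
  | cons {t : SandTree B} {ts : SandTreeList B} : IsC t → IsCL ts → IsCL (.cons t ts)
end

/-- Terms generated by the non-terminal `A` of the normal-form grammar. -/
def IsA {B : Type} (t : SandTree B) : Prop := IsC t ∨ IsS t

/-- Terms generated by the non-terminal `N` of the normal-form grammar; as terms
are considered modulo commutativity of `OR` and `AND`, the arguments of the `OR`
are required to be pairwise distinct modulo commutativity. -/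
def IsN {B : Type} (t : SandTree B) : Prop :=
  IsA t ∨ ∃ ts : SandTreeList B, t = .or ts ∧ 2 ≤ ts.toList.length ∧
    (∀ u ∈ ts.toList, IsA u) ∧ ts.toList.Pairwise (fun a b => ¬ PEq a b)

/-!
The term rewriting system obtained by orienting the axioms
(E3), (E4), (E4'), (E5), (E6), (E6'), (E10), (E10'), (E11) from left to right,
applied in any context, modulo commutativity of `OR` and `AND`.
-/

section
open SandTreeList

/-- Rule application at the root. -/
inductive RStep {B : Type} : SandTree B → SandTree B → Prop
  | r3 (xs : List (SandTree B)) (ys : SandTreeList B) :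
      RStep (.or (glue xs (.single (.or ys)))) (.or (glue xs ys))
  | r4 (xs : List (SandTree B)) (ys : SandTreeList B) :
      RStep (.and (glue xs (.single (.and ys)))) (.and (glue xs ys))
  | r4' (xs : List (SandTree B)) (ys : SandTreeList B) (zs : List (SandTree B)) :
      RStep (.sand (glue xs (snoc (.single (.sand ys)) zs))) (.sand (glue xs (snoc ys zs)))
  | r5 (t : SandTree B) : RStep (.or (.single t)) t
  | r6 (t : SandTree B) : RStep (.and (.single t)) t
  | r6' (t : SandTree B) : RStep (.sand (.single t)) t
  | r10 (xs : List (SandTree B)) (ys : SandTreeList B) :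
      RStep (.and (glue xs (.single (.or ys))))
        (.or (SandTreeList.map (fun y => .and (glue xs (.single y))) ys))
  | r10' (xs : List (SandTree B)) (ys : SandTreeList B) (zs : List (SandTree B)) :
      RStep (.sand (glue xs (snoc (.single (.or ys)) zs)))
        (.or (SandTreeList.map (fun y => .sand (glue xs (snoc (.single y) zs))) ys))
  | r11 (a : SandTree B) (xs : List (SandTree B)) :
      RStep (.or (.cons a (ofList a xs))) (.or (ofList a xs))

end

/-! Rule application in an arbitrary context. -/
mutual
inductive Rw {B : Type} : SandTree B → SandTree B → Prop
  | root {t t' : SandTree B} : RStep t t' → Rw t t'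
  | or {ts ts' : SandTreeList B} : RwL ts ts' → Rw (.or ts) (.or ts')
  | and {ts ts' : SandTreeList B} : RwL ts ts' → Rw (.and ts) (.and ts')
  | sand {ts ts' : SandTreeList B} : RwL ts ts' → Rw (.sand ts) (.sand ts')
inductive RwL {B : Type} : SandTreeList B → SandTreeList B → Prop
  | single {t t' : SandTree B} : Rw t t' → RwL (.single t) (.single t')
  | head {t t' : SandTree B} {ts : SandTreeList B} : Rw t t' → RwL (.cons t ts) (.cons t' ts)
  | tail {t : SandTree B} {ts ts' : SandTreeList B} : RwL ts ts' → RwL (.cons t ts) (.cons t ts')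
end

/-- One rewrite step of the TRS `⇒`, working modulo commutativity of `OR` and `AND`. -/
def RwMod {B : Type} (t t' : SandTree B) : Prop :=
  ∃ u u' : SandTree B, PEq t u ∧ Rw u u' ∧ PEq u' t'

/-- Zero or more rewrite steps (modulo commutativity of `OR` and `AND`). -/
def RwStar {B : Type} : SandTree B → SandTree B → Prop :=
  Relation.ReflTransGen (fun a b => PEq a b ∨ Rw a b)

/-- A normal form: no rewrite rule is applicable, modulo commutativity of `OR` and `AND`. -/
def NormalForm {B : Type} (t : SandTree B) : Prop :=
  ∀ u t' : SandTree B, PEq t u → ¬ Rw u t'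

/-! The norm `‖·‖`: `‖b‖ = 1`, `‖OR(t₁,…,t_k)‖ = ‖t₁‖+…+‖t_k‖+2`,
`‖AND(t₁,…,t_k)‖ = ‖SAND(t₁,…,t_k)‖ = 2·‖t₁‖·…·‖t_k‖`. -/
mutual
def weight {B : Type} : SandTree B → ℕ
  | .atom _ => 1
  | .or ts => weightSum ts + 2
  | .and ts => 2 * weightProd ts
  | .sand ts => 2 * weightProd ts
def weightSum {B : Type} : SandTreeList B → ℕ
  | .single t => weight t
  | .cons t ts => weight t + weightSum ts
def weightProd {B : Type} : SandTreeList B → ℕ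
  | .single t => weight t
  | .cons t ts => weight t * weightProd ts
end
/-!
Standard attack trees are SAND attack trees containing no `SAND` operator.
The multiset semantics maps a standard attack tree to a set of finite multisets
over `B`: `⟦b⟧_M = {⟨b⟩}`, `⟦OR⟧_M = ⋃ᵢ ⟦tᵢ⟧_M`,
`⟦AND⟧_M = {M₁ ⊎ … ⊎ M_k | Mᵢ ∈ ⟦tᵢ⟧_M}`.
(Its value on trees containing `SAND` is irrelevant and set to `∅`.)
-/

mutual
inductive NoSand {B : Type} : SandTree B → Prop
  | atom (b : B) : NoSand (.atom b)
  | or {ts : SandTreeList B} : NoSandL ts → NoSand (.or ts)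
  | and {ts : SandTreeList B} : NoSandL ts → NoSand (.and ts)
inductive NoSandL {B : Type} : SandTreeList B → Prop
  | single {t : SandTree B} : NoSand t → NoSandL (.single t)
  | cons {t : SandTree B} {ts : SandTreeList B} : NoSand t → NoSandL ts → NoSandL (.cons t ts)
end

mutual
def msem {B : Type} : SandTree B → Set (Multiset B)
  | .atom b => {({b} : Multiset B)}
  | .or ts => msemOr ts
  | .and ts => msemAnd ts
  | .sand _ => ∅
def msemOr {B : Type} : SandTreeList B → Set (Multiset B)
  | .single t => msem t
  | .cons t ts => msem t ∪ msemOr ts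
def msemAnd {B : Type} : SandTreeList B → Set (Multiset B)
  | .single t => msem t
  | .cons t ts => {M | ∃ M1 ∈ msem t, ∃ M2 ∈ msemAnd ts, M = M1 + M2}
end

/-- Parallel composition of a nonempty list of graphs `G ∥ H₁ ∥ … ∥ H_k`. -/
def parAll {B : Type} : SSG B → List (SSG B) → SSG B
  | G, [] => G
  | G, H :: Hs => parAll (G.par H) Hs

/-- SAND attack trees modulo equivalence with respect to the SP semantics
(`t ~ t'` iff `⟦t⟧ = ⟦t'⟧`). -/
def semSetoid (B : Type) : Setoid (SandTree B) :=
  ⟨fun t t' => sem t = sem t', fun _ => rfl, Eq.symm, Eq.trans⟩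

/-- The map induced by the SP semantics on equivalence classes of SAND attack trees. -/
def semClass {B : Type} : Quotient (semSetoid B) → Set (SSG B) :=
  Quotient.lift sem (fun _ _ h => h)

/-!
Bottom-up evaluation of the minimal attack time attribute on SAND attack trees:
`α(b) = β(b)`, `α(OR) = min`, `α(AND) = max`, `α(SAND) = Σ`.
-/

mutual
def attr {B : Type} (β : B → NNReal) : SandTree B → NNReal
  | .atom b => β b
  | .or ts => attrOr β ts
  | .and ts => attrAnd β ts
  | .sand ts => attrSand β ts
def attrOr {B : Type} (β : B → NNReal) : SandTreeList B → NNReal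
  | .single t => attr β t
  | .cons t ts => min (attr β t) (attrOr β ts)
def attrAnd {B : Type} (β : B → NNReal) : SandTreeList B → NNReal
  | .single t => attr β t
  | .cons t ts => max (attr β t) (attrAnd β ts)
def attrSand {B : Type} (β : B → NNReal) : SandTreeList B → NNReal
  | .single t => attr β t
  | .cons t ts => attr β t + attrSand β ts
end
/-!
Standard attack trees as a standalone signature (`B ∪ {OR, AND}`, unranked
operators with `k ≥ 1` arguments), their multiset semantics, and syntactic
consequence from the axiom system `E_SM`.
-/

mutual
inductive ATree (B : Type) : Type
  | atom : B → ATree B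
  | or : ATreeList B → ATree B
  | and : ATreeList B → ATree B
inductive ATreeList (B : Type) : Type
  | single : ATree B → ATreeList B
  | cons : ATree B → ATreeList B → ATreeList B
end

namespace ATreeList

variable {B : Type}

def toList : ATreeList B → List (ATree B)
  | .single t => [t]
  | .cons t ts => t :: ts.toList

def glue : List (ATree B) → ATreeList B → ATreeList B
  | [], ys => ys
  | x :: xs, ys => .cons x (glue xs ys)

def ofList : ATree B → List (ATree B) → ATreeList B
  | t, [] => .single t
  | t, u :: us => .cons t (ofList u us)

def map (f : ATree B → ATree B) : ATreeList B → ATreeList B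
  | .single t => .single (f t)
  | .cons t ts => .cons (f t) (map f ts)

end ATreeList

/-! The multiset semantics of standard attack trees. -/

mutual
def amsem {B : Type} : ATree B → Set (Multiset B)
  | .atom b => {({b} : Multiset B)}
  | .or ts => amsemOr ts
  | .and ts => amsemAnd ts
def amsemOr {B : Type} : ATreeList B → Set (Multiset B)
  | .single t => amsem t
  | .cons t ts => amsem t ∪ amsemOr ts
def amsemAnd {B : Type} : ATreeList B → Set (Multiset B)
  | .single t => amsem t
  | .cons t ts => {M | ∃ M1 ∈ amsem t, ∃ M2 ∈ amsemAnd ts, M = M1 + M2}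
end

/-!
Syntactic consequence from `E_SM = {E1, E2, E3, E4, E5, E6, E10, E11}`.
Axiom schemes are represented by all of their instances (closure under
substitution is then automatic), and closure under replacement in contexts is
represented by the congruence rules.
-/

section
open ATreeList
mutual
inductive DerivASM {B : Type} : ATree B → ATree B → Prop
  | refl (t : ATree B) : DerivASM t t
  | symm {t u : ATree B} : DerivASM t u → DerivASM u t
  | trans {t u v : ATree B} : DerivASM t u → DerivASM u v → DerivASM t v
  | congrOr {ts ts' : ATreeList B} : DerivASML ts ts' → DerivASM (.or ts) (.or ts')
  | congrAnd {ts ts' : ATreeList B} : DerivASML ts ts' → DerivASM (.and ts) (.and ts')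
  /- (E1) -/
  | ax1 {ts ts' : ATreeList B} : ts.toList.Perm ts'.toList → DerivASM (.or ts) (.or ts')
  /- (E2) -/
  | ax2 {ts ts' : ATreeList B} : ts.toList.Perm ts'.toList → DerivASM (.and ts) (.and ts')
  /- (E3) -/
  | ax3 (xs : List (ATree B)) (ys : ATreeList B) :
      DerivASM (.or (glue xs (.single (.or ys)))) (.or (glue xs ys))
  /- (E4) -/
  | ax4 (xs : List (ATree B)) (ys : ATreeList B) :
      DerivASM (.and (glue xs (.single (.and ys)))) (.and (glue xs ys))
  /- (E5) -/
  | ax5 (t : ATree B) : DerivASM (.or (.single t)) t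
  /- (E6) -/
  | ax6 (t : ATree B) : DerivASM (.and (.single t)) t
  /- (E10) -/
  | ax10 (xs : List (ATree B)) (ys : ATreeList B) :
      DerivASM (.and (glue xs (.single (.or ys))))
        (.or (ATreeList.map (fun y => .and (glue xs (.single y))) ys))
  /- (E11) -/
  | ax11 (a : ATree B) (xs : List (ATree B)) :
      DerivASM (.or (.cons a (ofList a xs))) (.or (ofList a xs))
inductive DerivASML {B : Type} : ATreeList B → ATreeList B → Prop
  | single {t t' : ATree B} : DerivASM t t' → DerivASML (.single t) (.single t')
  | cons {t t' : ATree B} {ts ts' : ATreeList B} :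
      DerivASM t t' → DerivASML ts ts' → DerivASML (.cons t ts) (.cons t' ts')
end
end
namespace SandTreeList

variable {B : Type}

@[simp]
theorem toList_glue (xs : List (SandTree B)) (ys : SandTreeList B) :
    (glue xs ys).toList = xs ++ ys.toList := by
  induction xs with
  | nil => rfl
  | cons x xs ih => simp [glue, toList, ih]

@[simp]
theorem toList_ofList (t : SandTree B) (l : List (SandTree B)) :
    (ofList t l).toList = t :: l := by
  induction l generalizing t with
  | nil => rfl
  | cons u us ih => simp [ofList, toList, ih]

@[simp]
theorem toList_snoc : ∀ (ys : SandTreeList B) (zs : List (SandTree B)),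
    (snoc ys zs).toList = ys.toList ++ zs
  | .single t, zs => by simp [snoc, toList]
  | .cons t ts, zs => by simp [snoc, toList, toList_snoc ts zs]

theorem toList_ne_nil (ts : SandTreeList B) : ts.toList ≠ [] := by
  cases ts <;> simp [toList]

theorem toList_injective : ∀ {ts us : SandTreeList B}, ts.toList = us.toList → ts = us
  | .single t, .single u, h => by simpa [toList] using h
  | .single t, .cons u us, h => by simp [toList, us.toList_ne_nil.symm] at h
  | .cons t ts, .single u, h => by simp [toList, ts.toList_ne_nil] at h
  | .cons t ts, .cons u us, h => by
    simp only [toList, List.cons.injEq] at h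
    rw [h.1, toList_injective h.2]

theorem exists_eq_glue_snoc {ts : SandTreeList B} {t : SandTree B} (h : t ∈ ts.toList) :
    ∃ xs zs, ts = glue xs (snoc (.single t) zs) := by
  obtain ⟨xs, zs, h⟩ := List.append_of_mem h
  exact ⟨xs, zs, toList_injective (by simp [h, toList])⟩

end SandTreeList

open SandTreeList

/-! ### The weight is a termination measure -/

theorem weightProd_eq {B : Type} : ∀ ts : SandTreeList B,
    weightProd ts = (ts.toList.map weight).prod
  | .single t => by simp [weightProd, toList]
  | .cons t ts => by simp [weightProd, toList, weightProd_eq ts]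

theorem weightSum_eq {B : Type} : ∀ ts : SandTreeList B,
    weightSum ts = (ts.toList.map weight).sum
  | .single t => by simp [weightSum, toList]
  | .cons t ts => by simp [weightSum, toList, weightSum_eq ts]

mutual
theorem weight_pos {B : Type} : ∀ t : SandTree B, 0 < weight t
  | .atom _ => by simp [weight]
  | .or ts => by simp [weight]
  | .and ts => by simpa [weight] using weightProd_pos ts
  | .sand ts => by simpa [weight] using weightProd_pos ts
theorem weightProd_pos {B : Type} : ∀ ts : SandTreeList B, 0 < weightProd ts
  | .single t => by simpa [weightProd] using weight_pos t
  | .cons t ts => by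
    simpa [weightProd] using ⟨weight_pos t, weightProd_pos ts⟩
end

theorem weightProd_list_pos {B : Type} (l : List (SandTree B)) : 0 < (l.map weight).prod :=
  List.prod_pos (by simpa using fun t _ => weight_pos t)

theorem weightSum_map {B : Type} (f : SandTree B → SandTree B) (c : ℕ)
    (h : ∀ t, weight (f t) = c * weight t) :
    ∀ ts : SandTreeList B, weightSum (ts.map f) = c * weightSum ts
  | .single t => by simp [weightSum, SandTreeList.map, h]
  | .cons t ts => by simp [weightSum, SandTreeList.map, h, weightSum_map f c h ts, mul_add]

mutual
theorem PEq.weight_eq {B : Type} {t u : SandTree B} : PEq t u → weight t = weight u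
  | .refl _ => rfl
  | .symm h => h.weight_eq.symm
  | .trans h h' => h.weight_eq.trans h'.weight_eq
  | .orPerm h => by simp only [weight, weightSum_eq, (h.map weight).sum_eq]
  | .andPerm h => by simp only [weight, weightProd_eq, (h.map weight).prod_eq]
  | .orCongr h => by simp only [weight, h.weight_eq.1]
  | .andCongr h => by simp only [weight, h.weight_eq.2]
  | .sandCongr h => by simp only [weight, h.weight_eq.2]
theorem PEqL.weight_eq {B : Type} {ts us : SandTreeList B} :
    PEqL ts us → weightSum ts = weightSum us ∧ weightProd ts = weightProd us
  | .single h => by simp only [weightSum, weightProd, h.weight_eq, and_self]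
  | .cons h h' => by
    simp only [weightSum, weightProd, h.weight_eq, h'.weight_eq.1, h'.weight_eq.2, and_self]
end

theorem RStep.weight_lt {B : Type} {t u : SandTree B} (h : RStep t u) : weight u < weight t := by
  cases h with
  | r3 xs ys => simp [weight, weightSum_eq, toList]
  | r4 xs ys =>
    have := weightProd_list_pos (xs ++ ys.toList)
    simp only [weight, weightProd_eq, toList_glue, toList, List.map_append, List.prod_append,
      List.map_cons, List.map_nil, List.prod_cons, List.prod_nil] at this ⊢
    nlinarith
  | r4' xs ys zs =>
    have := weightProd_list_pos (xs ++ (ys.toList ++ zs))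
    simp only [weight, weightProd_eq, toList_glue, toList_snoc, toList, List.map_append,
      List.prod_append, List.map_cons, List.map_nil, List.prod_cons, List.prod_nil] at this ⊢
    nlinarith
  | r5 => simp only [weight, weightSum]; omega
  | r6 => have := weight_pos u; simp only [weight, weightProd]; omega
  | r6' => have := weight_pos u; simp only [weight, weightProd]; omega
  | r10 xs ys =>
    have hx := weightProd_list_pos xs
    rw [weight, weightSum_map _ (2 * (xs.map weight).prod)
      (by intro t; simp [weight, weightProd_eq, toList, mul_assoc])]
    simp only [weight, weightProd_eq, toList_glue, toList, List.map_append, List.prod_append,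
      List.map_cons, List.map_nil, List.prod_cons, List.prod_nil]
    nlinarith
  | r10' xs ys zs =>
    have hx := weightProd_list_pos (xs ++ zs)
    rw [weight, weightSum_map _ (2 * ((xs ++ zs).map weight).prod)
      (by intro t; simp [weight, weightProd_eq, toList]; ring)]
    simp only [weight, weightProd_eq, toList_glue, toList_snoc, toList, List.map_append,
      List.prod_append, List.map_cons, List.map_nil, List.prod_cons, List.prod_nil] at hx ⊢
    nlinarith
  | r11 a xs =>
    have := weight_pos a
    simp only [weight, weightSum]; omega

mutual
theorem Rw.weight_lt {B : Type} {t u : SandTree B} : Rw t u → weight u < weight t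
  | .root h => h.weight_lt
  | .or h => by simpa [weight] using h.weight_lt.1
  | .and h => by simpa [weight] using h.weight_lt.2
  | .sand h => by simpa [weight] using h.weight_lt.2
theorem RwL.weight_lt {B : Type} {ts us : SandTreeList B} :
    RwL ts us → weightSum us < weightSum ts ∧ weightProd us < weightProd ts
  | .single h => ⟨h.weight_lt, h.weight_lt⟩
  | .head (ts := ts) h => by
    simpa [weightSum, weightProd, weightProd_pos ts] using h.weight_lt
  | .tail (t := t) h => by
    simpa [weightSum, weightProd, weight_pos t] using h.weight_lt
end

theorem exists_normalForm {B : Type} (t : SandTree B) :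
    ∃ n : SandTree B, RwStar t n ∧ NormalForm n := by
  by_cases hn : NormalForm t
  · exact ⟨t, .refl, hn⟩
  · simp only [NormalForm, not_forall, not_not] at hn
    obtain ⟨u, t', hu, ht'⟩ := hn
    have hlt : weight t' < weight t := hu.weight_eq ▸ ht'.weight_lt
    obtain ⟨n, hs, hn⟩ := exists_normalForm t'
    exact ⟨n, .head (.inl hu) (.head (.inr ht') hs), hn⟩
termination_by weight t

/-! ### Trees modulo commutativity -/

theorem PEqL.refl {B : Type} : ∀ ts : SandTreeList B, PEqL ts ts
  | .single t => .single (.refl t)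
  | .cons t ts => .cons (.refl t) (.refl ts)

def pEqSetoid (B : Type) : Setoid (SandTree B) :=
  ⟨PEq, PEq.refl, PEq.symm, PEq.trans⟩

/-- SAND attack trees modulo commutativity of `OR` and `AND`. -/
abbrev TreeClass (B : Type) : Type := Quotient (pEqSetoid B)

def treeClass {B : Type} (t : SandTree B) : TreeClass B := Quotient.mk (pEqSetoid B) t

theorem treeClass_eq_iff {B : Type} {t u : SandTree B} :
    treeClass t = treeClass u ↔ PEq t u :=
  Quotient.eq (r := pEqSetoid B)

theorem PEqL.iff_map_eq {B : Type} : ∀ {ts us : SandTreeList B},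
    PEqL ts us ↔ ts.toList.map treeClass = us.toList.map treeClass
  | .single t, .single u => by
    simp only [toList, List.map_cons, List.map_nil, List.cons.injEq, and_true, treeClass_eq_iff]
    exact ⟨fun | .single h => h, .single⟩
  | .single t, .cons u us => by
    simp only [toList, List.map_cons, List.map_nil, List.cons.injEq]
    exact ⟨nofun, fun h => by simp [us.toList_ne_nil] at h⟩
  | .cons t ts, .single u => by
    simp only [toList, List.map_cons, List.map_nil, List.cons.injEq]
    exact ⟨nofun, fun h => by simp [ts.toList_ne_nil] at h⟩
  | .cons t ts, .cons u us => by
    simp only [toList, List.map_cons, List.cons.injEq, treeClass_eq_iff]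
    exact ⟨fun | .cons h h' => ⟨h, PEqL.iff_map_eq.1 h'⟩, fun h => .cons h.1 (PEqL.iff_map_eq.2 h.2)⟩

/-- Argument lists that agree up to a permutation and `PEq` can be matched by
first choosing equal representatives and then permuting. -/
theorem exists_perm_of_map_perm {B : Type} {ts us : SandTreeList B}
    (h : (ts.toList.map treeClass).Perm (us.toList.map treeClass)) :
    ∃ ts' us', PEqL ts ts' ∧ ts'.toList.Perm us'.toList ∧ PEqL us' us := by
  have rep : ∀ vs : SandTreeList B, ∃ vs' : SandTreeList B,
      vs'.toList = (vs.toList.map treeClass).map Quotient.out ∧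
        vs'.toList.map treeClass = vs.toList.map treeClass := by
    intro vs
    have key : ((vs.toList.map treeClass).map Quotient.out).map treeClass =
        vs.toList.map treeClass := by
      rw [List.map_map]
      exact (List.map_congr_left fun q _ => Quotient.out_eq q).trans (List.map_id _)
    rcases e : (vs.toList.map treeClass).map Quotient.out with _ | ⟨v, l⟩
    · simp [vs.toList_ne_nil] at e
    · exact ⟨ofList v l, toList_ofList v l, by rw [toList_ofList, ← e, key]⟩
  obtain ⟨ts', h1, h2⟩ := rep ts
  obtain ⟨us', h3, h4⟩ := rep us
  exact ⟨ts', us', PEqL.iff_map_eq.2 h2.symm, by rw [h1, h3]; exact h.map _, PEqL.iff_map_eq.2 h4⟩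

theorem PEq.or_of_map_perm {B : Type} {ts us : SandTreeList B}
    (h : (ts.toList.map treeClass).Perm (us.toList.map treeClass)) : PEq (.or ts) (.or us) := by
  obtain ⟨ts', us', h1, h2, h3⟩ := exists_perm_of_map_perm h
  exact (PEq.orCongr h1).trans ((PEq.orPerm h2).trans (.orCongr h3))

theorem PEq.and_of_map_perm {B : Type} {ts us : SandTreeList B}
    (h : (ts.toList.map treeClass).Perm (us.toList.map treeClass)) : PEq (.and ts) (.and us) := by
  obtain ⟨ts', us', h1, h2, h3⟩ := exists_perm_of_map_perm h
  exact (PEq.andCongr h1).trans ((PEq.andPerm h2).trans (.andCongr h3))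

/-! ### Flattened conjunctions -/

namespace SandTree

variable {B : Type}

def andArgs : SandTree B → SandTreeList B
  | .and ts => ts
  | t => .single t

def sandArgs : SandTree B → SandTreeList B
  | .sand ts => ts
  | t => .single t

/-- The flattened conjunction of two trees. -/
def par (t u : SandTree B) : SandTree B := .and (glue t.andArgs.toList u.andArgs)

/-- The flattened sequential conjunction of two trees. -/
def seq (t u : SandTree B) : SandTree B := .sand (glue t.sandArgs.toList u.sandArgs)

theorem par_assoc (t u v : SandTree B) : (t.par u).par v = t.par (u.par v) := by
  simp only [par, andArgs]
  congr 1
  exact toList_injective (by simp)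

theorem seq_assoc (t u v : SandTree B) : (t.seq u).seq v = t.seq (u.seq v) := by
  simp only [seq, sandArgs]
  congr 1
  exact toList_injective (by simp)

theorem par_comm (t u : SandTree B) : PEq (t.par u) (u.par t) :=
  .andPerm (by simpa using List.perm_append_comm)

end SandTree

theorem PEq.andArgs_perm {B : Type} {t u : SandTree B} (h : PEq t u) :
    (t.andArgs.toList.map treeClass).Perm (u.andArgs.toList.map treeClass) := by
  match h with
  | .refl _ => exact .refl _
  | .symm h => exact h.andArgs_perm.symm
  | .trans h h' => exact h.andArgs_perm.trans h'.andArgs_perm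
  | .orPerm h => simp [SandTree.andArgs, toList, treeClass_eq_iff.2 (PEq.orPerm h)]
  | .andPerm h => exact h.map _
  | .orCongr h => simp [SandTree.andArgs, toList, treeClass_eq_iff.2 (PEq.orCongr h)]
  | .andCongr h => simp only [SandTree.andArgs, PEqL.iff_map_eq.1 h, List.Perm.refl]
  | .sandCongr h => simp [SandTree.andArgs, toList, treeClass_eq_iff.2 (PEq.sandCongr h)]

theorem PEq.sandArgs_eq {B : Type} {t u : SandTree B} (h : PEq t u) :
    t.sandArgs.toList.map treeClass = u.sandArgs.toList.map treeClass := by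
  match h with
  | .refl _ => rfl
  | .symm h => exact h.sandArgs_eq.symm
  | .trans h h' => exact h.sandArgs_eq.trans h'.sandArgs_eq
  | .orPerm h => simp [SandTree.sandArgs, toList, treeClass_eq_iff.2 (PEq.orPerm h)]
  | .andPerm h => simp [SandTree.sandArgs, toList, treeClass_eq_iff.2 (PEq.andPerm h)]
  | .orCongr h => simp [SandTree.sandArgs, toList, treeClass_eq_iff.2 (PEq.orCongr h)]
  | .andCongr h => simp [SandTree.sandArgs, toList, treeClass_eq_iff.2 (PEq.andCongr h)]
  | .sandCongr h => exact PEqL.iff_map_eq.1 h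

namespace TreeClass

variable {B : Type}

def par : TreeClass B → TreeClass B → TreeClass B :=
  Quotient.map₂ SandTree.par fun _ _ h _ _ h' =>
    PEq.and_of_map_perm (by simpa using (PEq.andArgs_perm h).append (PEq.andArgs_perm h'))

def seq : TreeClass B → TreeClass B → TreeClass B :=
  Quotient.map₂ SandTree.seq fun _ _ h _ _ h' =>
    PEq.sandCongr (PEqL.iff_map_eq.2 (by simp [PEq.sandArgs_eq h, PEq.sandArgs_eq h']))

theorem par_assoc (x y z : TreeClass B) : (x.par y).par z = x.par (y.par z) := by
  induction x, y using Quotient.inductionOn₂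
  induction z using Quotient.inductionOn
  exact congrArg treeClass (SandTree.par_assoc _ _ _)

theorem seq_assoc (x y z : TreeClass B) : (x.seq y).seq z = x.seq (y.seq z) := by
  induction x, y using Quotient.inductionOn₂
  induction z using Quotient.inductionOn
  exact congrArg treeClass (SandTree.seq_assoc _ _ _)

theorem par_comm (x y : TreeClass B) : x.par y = y.par x := by
  induction x, y using Quotient.inductionOn₂
  exact treeClass_eq_iff.2 (SandTree.par_comm _ _)

/-- Sets of classes form a commutative semigroup under elementwise `par`. -/
abbrev setCommSemigroup (B : Type) : CommSemigroup (Set (TreeClass B)) where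
  mul := Set.image2 par
  mul_assoc _ _ _ := Set.image2_assoc par_assoc
  mul_comm _ _ := Set.image2_comm par_comm

end TreeClass

/-! ### The set of flattened disjuncts of a tree -/

mutual
/-- The disjuncts of a tree: the classes of the flattened `OR`-free trees obtained by
distributing `AND` and `SAND` over `OR`. -/
def disjuncts {B : Type} : SandTree B → Set (TreeClass B)
  | .atom b => {treeClass (.atom b)}
  | .or ts => disjunctsOr ts
  | .and ts => disjunctsAnd ts
  | .sand ts => disjunctsSand ts
def disjunctsOr {B : Type} : SandTreeList B → Set (TreeClass B)
  | .single t => disjuncts t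
  | .cons t ts => disjuncts t ∪ disjunctsOr ts
def disjunctsAnd {B : Type} : SandTreeList B → Set (TreeClass B)
  | .single t => disjuncts t
  | .cons t ts => Set.image2 TreeClass.par (disjuncts t) (disjunctsAnd ts)
def disjunctsSand {B : Type} : SandTreeList B → Set (TreeClass B)
  | .single t => disjuncts t
  | .cons t ts => Set.image2 TreeClass.seq (disjuncts t) (disjunctsSand ts)
end

theorem mem_disjunctsOr {B : Type} {x : TreeClass B} : ∀ {ts : SandTreeList B},
    x ∈ disjunctsOr ts ↔ ∃ t ∈ ts.toList, x ∈ disjuncts t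
  | .single t => by simp [disjunctsOr, toList]
  | .cons t ts => by simp [disjunctsOr, toList, mem_disjunctsOr (ts := ts)]

theorem coe_disjunctsAnd {B : Type} :
    letI := TreeClass.setCommSemigroup B
    ∀ ts : SandTreeList B, ((disjunctsAnd ts : Set (TreeClass B)) : WithOne (Set (TreeClass B))) =
      (ts.toList.map fun t => (disjuncts t : WithOne (Set (TreeClass B)))).prod
  | .single t => by
    let _ := TreeClass.setCommSemigroup B
    simp [disjunctsAnd, toList]
  | .cons t ts => by
    let _ := TreeClass.setCommSemigroup B
    simp only [toList, List.map_cons, List.prod_cons, ← coe_disjunctsAnd ts, disjunctsAnd]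
    exact WithOne.coe_mul _ _

theorem disjunctsAnd_perm {B : Type} {ts us : SandTreeList B} (h : ts.toList.Perm us.toList) :
    disjunctsAnd ts = disjunctsAnd us := by
  let _ := TreeClass.setCommSemigroup B
  rw [← WithOne.coe_inj, coe_disjunctsAnd, coe_disjunctsAnd]
  exact (h.map _).prod_eq

mutual
theorem PEq.disjuncts_eq {B : Type} {t u : SandTree B} : PEq t u → disjuncts t = disjuncts u
  | .refl _ => rfl
  | .symm h => h.disjuncts_eq.symm
  | .trans h h' => h.disjuncts_eq.trans h'.disjuncts_eq
  | .orPerm h => by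
    ext x
    simp only [disjuncts, mem_disjunctsOr, h.mem_iff]
  | .andPerm h => by simp only [disjuncts, disjunctsAnd_perm h]
  | .orCongr h => by simp only [disjuncts, h.disjuncts_eq.1]
  | .andCongr h => by simp only [disjuncts, h.disjuncts_eq.2.1]
  | .sandCongr h => by simp only [disjuncts, h.disjuncts_eq.2.2]
theorem PEqL.disjuncts_eq {B : Type} {ts us : SandTreeList B} :
    PEqL ts us → disjunctsOr ts = disjunctsOr us ∧ disjunctsAnd ts = disjunctsAnd us ∧
      disjunctsSand ts = disjunctsSand us
  | .single h => ⟨h.disjuncts_eq, h.disjuncts_eq, h.disjuncts_eq⟩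
  | .cons h h' => by
    obtain ⟨h1, h2, h3⟩ := h'.disjuncts_eq
    simp only [disjunctsOr, disjunctsAnd, disjunctsSand, h.disjuncts_eq, h1, h2, h3, and_self]
end

theorem disjunctsAnd_glue {B : Type} (xs : List (SandTree B)) (ys : SandTreeList B) :
    disjunctsAnd (glue xs ys) =
      xs.foldr (fun x S => Set.image2 TreeClass.par (disjuncts x) S) (disjunctsAnd ys) := by
  induction xs with
  | nil => rfl
  | cons x xs ih => simp only [glue, disjunctsAnd, ih, List.foldr_cons]

theorem disjunctsSand_glue {B : Type} (xs : List (SandTree B)) (ys : SandTreeList B) :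
    disjunctsSand (glue xs ys) =
      xs.foldr (fun x S => Set.image2 TreeClass.seq (disjuncts x) S) (disjunctsSand ys) := by
  induction xs with
  | nil => rfl
  | cons x xs ih => simp only [glue, disjunctsSand, ih, List.foldr_cons]

/-- The disjuncts of a sequential conjunction whose initial part has disjuncts `S`. -/
def disjunctsSandFrom {B : Type} (S : Set (TreeClass B)) : List (SandTree B) → Set (TreeClass B)
  | [] => S
  | z :: zs => Set.image2 TreeClass.seq S (disjunctsSandFrom (disjuncts z) zs)

theorem disjunctsSand_ofList {B : Type} (t : SandTree B) (zs : List (SandTree B)) :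
    disjunctsSand (ofList t zs) = disjunctsSandFrom (disjuncts t) zs := by
  induction zs generalizing t with
  | nil => rfl
  | cons z zs ih => simp only [ofList, disjunctsSand, ih, disjunctsSandFrom]

theorem disjunctsSand_snoc {B : Type} : ∀ (ys : SandTreeList B) (zs : List (SandTree B)),
    disjunctsSand (snoc ys zs) = disjunctsSandFrom (disjunctsSand ys) zs
  | .single t, zs => disjunctsSand_ofList t zs
  | .cons t ts, [] => by
    simp only [snoc, disjunctsSand, disjunctsSand_snoc ts [], disjunctsSandFrom]
  | .cons t ts, z :: zs => by
    simp only [snoc, disjunctsSand, disjunctsSand_snoc ts (z :: zs), disjunctsSandFrom]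
    exact (Set.image2_assoc TreeClass.seq_assoc).symm

theorem foldr_image2_union {B : Type} (f : TreeClass B → TreeClass B → TreeClass B)
    (xs : List (SandTree B)) (S T : Set (TreeClass B)) :
    xs.foldr (fun x S => Set.image2 f (disjuncts x) S) (S ∪ T) =
      xs.foldr (fun x S => Set.image2 f (disjuncts x) S) S ∪
        xs.foldr (fun x S => Set.image2 f (disjuncts x) S) T := by
  induction xs with
  | nil => rfl
  | cons x xs ih => simp only [List.foldr_cons, ih, Set.image2_union_right]

theorem disjunctsSandFrom_union {B : Type} (zs : List (SandTree B)) (S T : Set (TreeClass B)) :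
    disjunctsSandFrom (S ∪ T) zs = disjunctsSandFrom S zs ∪ disjunctsSandFrom T zs := by
  cases zs with
  | nil => rfl
  | cons z zs => exact Set.image2_union_left

theorem disjunctsOr_map {B : Type} (f : SandTree B → SandTree B)
    (F : Set (TreeClass B) → Set (TreeClass B)) (hF : ∀ S T, F (S ∪ T) = F S ∪ F T)
    (hf : ∀ t, disjuncts (f t) = F (disjuncts t)) :
    ∀ ts : SandTreeList B, disjunctsOr (ts.map f) = F (disjunctsOr ts)
  | .single t => hf t
  | .cons t ts => by
    simp only [SandTreeList.map, disjunctsOr, hf, hF, disjunctsOr_map f F hF hf ts]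

theorem RStep.disjuncts_eq {B : Type} {t u : SandTree B} (h : RStep t u) :
    disjuncts t = disjuncts u := by
  cases h with
  | r3 xs ys =>
    ext x
    simp [disjuncts, mem_disjunctsOr, toList, or_and_right, exists_or]
  | r4 xs ys => simp only [disjuncts, disjunctsAnd_glue, disjunctsAnd]
  | r4' xs ys zs =>
    simp only [disjuncts, disjunctsSand_glue, disjunctsSand_snoc, disjunctsSand]
  | r5 => rfl
  | r6 => rfl
  | r6' => rfl
  | r10 xs ys =>
    simp only [disjuncts, disjunctsAnd_glue, disjunctsAnd]
    refine (disjunctsOr_map _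
      (fun S => xs.foldr (fun x S => Set.image2 TreeClass.par (disjuncts x) S) S)
      (foldr_image2_union _ xs) (fun t => ?_) ys).symm
    simp only [disjuncts, disjunctsAnd_glue, disjunctsAnd]
  | r10' xs ys zs =>
    simp only [disjuncts, disjunctsSand_glue, disjunctsSand_snoc, disjunctsSand]
    refine (disjunctsOr_map _
      (fun S => xs.foldr (fun x S => Set.image2 TreeClass.seq (disjuncts x) S)
        (disjunctsSandFrom S zs))
      (fun S T => by simp only [disjunctsSandFrom_union, foldr_image2_union])
      (fun t => ?_) ys).symm
    simp only [disjuncts, disjunctsSand_glue, disjunctsSand_snoc, disjunctsSand]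
  | r11 a xs =>
    ext x
    simp [disjuncts, mem_disjunctsOr, toList]

mutual
theorem Rw.disjuncts_eq {B : Type} {t u : SandTree B} : Rw t u → disjuncts t = disjuncts u
  | .root h => h.disjuncts_eq
  | .or h => by simp only [disjuncts, h.disjuncts_eq.1]
  | .and h => by simp only [disjuncts, h.disjuncts_eq.2.1]
  | .sand h => by simp only [disjuncts, h.disjuncts_eq.2.2]
theorem RwL.disjuncts_eq {B : Type} {ts us : SandTreeList B} :
    RwL ts us → disjunctsOr ts = disjunctsOr us ∧ disjunctsAnd ts = disjunctsAnd us ∧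
      disjunctsSand ts = disjunctsSand us
  | .single h => ⟨h.disjuncts_eq, h.disjuncts_eq, h.disjuncts_eq⟩
  | .head h => by
    simp only [disjunctsOr, disjunctsAnd, disjunctsSand, h.disjuncts_eq, and_self]
  | .tail h => by
    obtain ⟨h1, h2, h3⟩ := h.disjuncts_eq
    simp only [disjunctsOr, disjunctsAnd, disjunctsSand, h1, h2, h3, and_self]
end

theorem RwStar.disjuncts_eq {B : Type} {t u : SandTree B} (h : RwStar t u) :
    disjuncts t = disjuncts u := by
  induction h with
  | refl => rfl
  | tail _ h ih => exact ih.trans (h.elim PEq.disjuncts_eq Rw.disjuncts_eq)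

/-! ### The shape of normal forms -/

theorem PEqL.glue_snoc {B : Type} {t u : SandTree B} (h : PEq t u) (xs zs : List (SandTree B)) :
    PEqL (glue xs (snoc (.single t) zs)) (glue xs (snoc (.single u) zs)) :=
  PEqL.iff_map_eq.2 (by simp [toList, treeClass_eq_iff.2 h])

theorem RwL.glue_snoc {B : Type} {t u : SandTree B} (h : Rw t u) (xs zs : List (SandTree B)) :
    RwL (glue xs (snoc (.single t) zs)) (glue xs (snoc (.single u) zs)) := by
  induction xs with
  | nil =>
    cases zs with
    | nil => exact .single h
    | cons z zs => exact .head h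
  | cons x xs ih => exact .tail ih

theorem perm_glue_single {B : Type} (t : SandTree B) (xs zs : List (SandTree B)) :
    (glue xs (snoc (.single t) zs)).toList.Perm (glue (xs ++ zs) (.single t)).toList := by
  simpa [toList] using (List.perm_append_comm (l₁ := [t]) (l₂ := zs)).append_left xs

namespace NormalForm

variable {B : Type} {t : SandTree B} {ts : SandTreeList B}

theorem not_rStep (h : NormalForm t) {u v : SandTree B} (hu : PEq t u) : ¬ RStep u v :=
  fun hv => h u v hu (.root hv)

theorem of_mem_or (h : NormalForm (.or ts)) (ht : t ∈ ts.toList) : NormalForm t := by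
  obtain ⟨xs, zs, rfl⟩ := exists_eq_glue_snoc ht
  exact fun u v hu hv => h _ _ (.orCongr (.glue_snoc hu xs zs)) (.or (.glue_snoc hv xs zs))

theorem of_mem_and (h : NormalForm (.and ts)) (ht : t ∈ ts.toList) : NormalForm t := by
  obtain ⟨xs, zs, rfl⟩ := exists_eq_glue_snoc ht
  exact fun u v hu hv => h _ _ (.andCongr (.glue_snoc hu xs zs)) (.and (.glue_snoc hv xs zs))

theorem of_mem_sand (h : NormalForm (.sand ts)) (ht : t ∈ ts.toList) : NormalForm t := by
  obtain ⟨xs, zs, rfl⟩ := exists_eq_glue_snoc ht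
  exact fun u v hu hv => h _ _ (.sandCongr (.glue_snoc hu xs zs)) (.sand (.glue_snoc hv xs zs))

theorem or_notMem_or (h : NormalForm (.or ts)) (us : SandTreeList B) :
    .or us ∉ ts.toList := fun ht => by
  obtain ⟨xs, zs, rfl⟩ := exists_eq_glue_snoc ht
  exact h.not_rStep (.orPerm (perm_glue_single _ xs zs)) (.r3 _ _)

theorem or_notMem_and (h : NormalForm (.and ts)) (us : SandTreeList B) :
    .or us ∉ ts.toList := fun ht => by
  obtain ⟨xs, zs, rfl⟩ := exists_eq_glue_snoc ht
  exact h.not_rStep (.andPerm (perm_glue_single _ xs zs)) (.r10 _ _)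

theorem and_notMem_and (h : NormalForm (.and ts)) (us : SandTreeList B) :
    .and us ∉ ts.toList := fun ht => by
  obtain ⟨xs, zs, rfl⟩ := exists_eq_glue_snoc ht
  exact h.not_rStep (.andPerm (perm_glue_single _ xs zs)) (.r4 _ _)

theorem or_notMem_sand (h : NormalForm (.sand ts)) (us : SandTreeList B) :
    .or us ∉ ts.toList := fun ht => by
  obtain ⟨xs, zs, rfl⟩ := exists_eq_glue_snoc ht
  exact h.not_rStep (.refl _) (.r10' _ _ _)

theorem sand_notMem_sand (h : NormalForm (.sand ts)) (us : SandTreeList B) :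
    .sand us ∉ ts.toList := fun ht => by
  obtain ⟨xs, zs, rfl⟩ := exists_eq_glue_snoc ht
  exact h.not_rStep (.refl _) (.r4' _ _ _)

theorem nodup_or (h : NormalForm (.or ts)) : (ts.toList.map treeClass).Nodup := by
  rw [List.Nodup, List.pairwise_map, List.pairwise_iff_forall_sublist]
  intro a b hs hab
  obtain ⟨l, hl⟩ := hs.exists_perm_append
  refine h.not_rStep (PEq.or_of_map_perm ?_) (.r11 a l)
  simpa [toList, hab] using hl.map treeClass

end NormalForm

theorem disjunctsAnd_eq_singleton {B : Type} : ∀ {ts : SandTreeList B},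
    (∀ t ∈ ts.toList, t.andArgs = .single t ∧ disjuncts t = {treeClass t}) →
      ∃ t, t.andArgs = ts ∧ (∀ us vs, ts = .cons us vs → t = .and ts) ∧
        disjunctsAnd ts = {treeClass t}
  | .single t, h => by
    obtain ⟨h1, h2⟩ := h t (by simp [toList])
    exact ⟨t, h1, nofun, h2⟩
  | .cons t ts, h => by
    obtain ⟨h1, h2⟩ := h t (by simp [toList])
    obtain ⟨u, hu, -, h3⟩ := disjunctsAnd_eq_singleton (ts := ts)
      fun v hv => h v (by simp [toList, hv])
    refine ⟨.and (.cons t ts), rfl, fun _ _ _ => rfl, ?_⟩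
    rw [disjunctsAnd, h2, h3, Set.image2_singleton]
    congr 1
    change treeClass (t.par u) = _
    rw [SandTree.par, h1, hu]
    rfl

theorem disjunctsSand_eq_singleton {B : Type} : ∀ {ts : SandTreeList B},
    (∀ t ∈ ts.toList, t.sandArgs = .single t ∧ disjuncts t = {treeClass t}) →
      ∃ t, t.sandArgs = ts ∧ (∀ us vs, ts = .cons us vs → t = .sand ts) ∧
        disjunctsSand ts = {treeClass t}
  | .single t, h => by
    obtain ⟨h1, h2⟩ := h t (by simp [toList])
    exact ⟨t, h1, nofun, h2⟩
  | .cons t ts, h => by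
    obtain ⟨h1, h2⟩ := h t (by simp [toList])
    obtain ⟨u, hu, -, h3⟩ := disjunctsSand_eq_singleton (ts := ts)
      fun v hv => h v (by simp [toList, hv])
    refine ⟨.sand (.cons t ts), rfl, fun _ _ _ => rfl, ?_⟩
    rw [disjunctsSand, h2, h3, Set.image2_singleton]
    congr 1
    change treeClass (t.seq u) = _
    rw [SandTree.seq, h1, hu]
    rfl

theorem weight_lt_of_mem_and {B : Type} {t : SandTree B} {ts : SandTreeList B}
    (h : t ∈ ts.toList) : weight t < 2 * weightProd ts := by
  have h1 : weight t ∣ weightProd ts := by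
    rw [weightProd_eq]
    exact List.dvd_prod (List.mem_map_of_mem h)
  have h2 := Nat.le_of_dvd (weightProd_pos ts) h1
  have h3 := weightProd_pos ts
  omega

theorem NormalForm.disjuncts_eq_singleton {B : Type} (t : SandTree B) (hn : NormalForm t)
    (ho : ∀ us, t ≠ .or us) : disjuncts t = {treeClass t} := by
  match t with
  | .atom b => rfl
  | .or us => exact absurd rfl (ho us)
  | .and (.single t) => exact absurd (.r6 t) (hn.not_rStep (.refl _))
  | .sand (.single t) => exact absurd (.r6' t) (hn.not_rStep (.refl _))
  | .and (.cons u us) =>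
    obtain ⟨v, -, hv, h⟩ := disjunctsAnd_eq_singleton (ts := .cons u us) fun w hw =>
      ⟨by cases w with
        | and ws => exact absurd hw (hn.and_notMem_and ws)
        | _ => rfl,
        have := weight_lt_of_mem_and hw
        NormalForm.disjuncts_eq_singleton w (hn.of_mem_and hw)
          fun ws e => hn.or_notMem_and ws (e ▸ hw)⟩
    rw [disjuncts, h, hv u us rfl]
  | .sand (.cons u us) =>
    obtain ⟨v, -, hv, h⟩ := disjunctsSand_eq_singleton (ts := .cons u us) fun w hw =>
      ⟨by cases w with
        | sand ws => exact absurd hw (hn.sand_notMem_sand ws)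
        | _ => rfl,
        have := weight_lt_of_mem_and hw
        NormalForm.disjuncts_eq_singleton w (hn.of_mem_sand hw)
          fun ws e => hn.or_notMem_sand ws (e ▸ hw)⟩
    rw [disjuncts, h, hv u us rfl]
termination_by weight t
decreasing_by all_goals simpa only [weight] using this

theorem NormalForm.mem_disjuncts_or {B : Type} {ts : SandTreeList B} (hn : NormalForm (.or ts))
    {x : TreeClass B} : x ∈ disjuncts (.or ts) ↔ x ∈ ts.toList.map treeClass := by
  rw [disjuncts, mem_disjunctsOr, List.mem_map]
  refine exists_congr fun t => and_congr_right fun ht => ?_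
  rw [(hn.of_mem_or ht).disjuncts_eq_singleton t fun us e => hn.or_notMem_or us (e ▸ ht)]
  exact eq_comm

theorem NormalForm.disjuncts_or_ne_singleton {B : Type} {ts : SandTreeList B}
    (hn : NormalForm (.or ts)) (x : TreeClass B) : disjuncts (.or ts) ≠ {x} := by
  intro h
  have hx : ∀ y ∈ ts.toList.map treeClass, y = x := fun y hy => by
    simpa [h] using hn.mem_disjuncts_or.2 hy
  have hd := hn.nodup_or
  match ts with
  | .single t => exact hn.not_rStep (.refl _) (.r5 t)
  | .cons t us =>
    obtain ⟨u, hu⟩ := List.exists_mem_of_ne_nil _ us.toList_ne_nil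
    simp only [toList, List.map_cons, List.nodup_cons] at hd hx
    have hu' := List.mem_map_of_mem (f := treeClass) hu
    rw [hx _ (List.mem_cons_of_mem _ hu')] at hu'
    exact hd.1 (hx _ List.mem_cons_self ▸ hu')

theorem NormalForm.pEq_of_disjuncts_eq {B : Type} {t u : SandTree B} (ht : NormalForm t)
    (hu : NormalForm u) (h : disjuncts t = disjuncts u) : PEq t u := by
  by_cases hot : ∃ ts, t = .or ts <;> by_cases hou : ∃ us, u = .or us
  · obtain ⟨ts, rfl⟩ := hot
    obtain ⟨us, rfl⟩ := hou
    refine .or_of_map_perm ((List.perm_ext_iff_of_nodup ht.nodup_or hu.nodup_or).2 fun x => ?_)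
    rw [← ht.mem_disjuncts_or, h, hu.mem_disjuncts_or]
  · obtain ⟨ts, rfl⟩ := hot
    rw [hu.disjuncts_eq_singleton u (not_exists.1 hou)] at h
    exact absurd h (ht.disjuncts_or_ne_singleton _)
  · obtain ⟨us, rfl⟩ := hou
    rw [ht.disjuncts_eq_singleton t (not_exists.1 hot)] at h
    exact absurd h.symm (hu.disjuncts_or_ne_singleton _)
  · rw [ht.disjuncts_eq_singleton t (not_exists.1 hot),
      hu.disjuncts_eq_singleton u (not_exists.1 hou), Set.singleton_eq_singleton_iff] at h
    exact treeClass_eq_iff.1 h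

/-- Every SAND attack tree rewrites to a normal form, and normal
forms are unique up to permuting the arguments of `OR` and `AND` nodes. -/
theorem normalform_exists_unique (B : Type) :
    (∀ t : SandTree B, ∃ n : SandTree B, RwStar t n ∧ NormalForm n) ∧
    (∀ t n1 n2 : SandTree B, RwStar t n1 → NormalForm n1 → RwStar t n2 → NormalForm n2 →
      PEq n1 n2) :=
  ⟨exists_normalForm, fun _ _ _ h1 hn1 h2 hn2 =>
    hn1.pEq_of_disjuncts_eq hn2 (h1.disjuncts_eq.symm.trans h2.disjuncts_eq)⟩
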